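/- Stability of the BV curve tracking problem with quadratic fidelity: let fʲ → f̂ strongly in Y, and for each j let μʲ be a solution of min over μ ∈ 𝒜 of ½‖K(μ) − fʲ‖²_Y + 𝓡_{α,β}(μ). Then, up to a subsequence, μʲ_t ⇀* μ̂_t for a.e. t ∈ I for some μ̂ ∈ 𝒜, and μ̂ is a solution of min over μ ∈ 𝒜 of ½‖K(μ) − f̂‖²_Y + 𝓡_{α,β}(μ). -/

import Mathlib

open MeasureTheory Filter Topology Set
open scoped ENNReal NNReal RealInnerProductSpace

noncomputable section

/-- The unit time interval `[0,1] ⊆ ℝ`. -/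
def unitI : Set ℝ := Set.Icc 0 1

/-- Lebesgue measure restricted to the unit interval. -/
def lebI : Measure ℝ := volume.restrict unitI

/-- The (pointwise) variation of a curve `f : ℝ → X` on a set `s ⊆ ℝ`,
with respect to a distance function `d`. -/
def varOn {X : Type*} (d : X → X → ℝ≥0∞) (f : ℝ → X) (s : Set ℝ) : ℝ≥0∞ :=
  ⨆ p : ℕ × { u : ℕ → ℝ // Monotone u ∧ ∀ i, u i ∈ s },
    ∑ i ∈ Finset.range p.1, d (f (p.2.1 (i + 1))) (f (p.2.1 i))

/-- The essential variation of `f` on `s`: infimum of variations over a.e. representatives. -/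
def essVarOn {X : Type*} (d : X → X → ℝ≥0∞) (f : ℝ → X) (s : Set ℝ) : ℝ≥0∞ :=
  ⨅ g ∈ {g : ℝ → X | ∀ᵐ t ∂(volume.restrict s), g t = f t}, varOn d g s

/-- Essential variation on the unit interval. -/
def essVar {X : Type*} (d : X → X → ℝ≥0∞) (f : ℝ → X) : ℝ≥0∞ := essVarOn d f unitI

/-- Couplings (transport plans) between two measures. -/
def IsCoupling {X : Type*} [MeasurableSpace X] (ρp ρm : Measure X)
    (π : Measure (X × X)) : Prop :=
  π.map Prod.fst = ρp ∧ π.map Prod.snd = ρm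

/-- The Wasserstein-1 distance between measures. -/
def W1 {X : Type*} [MeasurableSpace X] [PseudoEMetricSpace X]
    (ρp ρm : Measure X) : ℝ≥0∞ :=
  ⨅ π ∈ {π : Measure (X × X) | IsCoupling ρp ρm π}, ∫⁻ q, edist q.1 q.2 ∂π

/-- `W1` as a distance function on measures. -/
def W1M {X : Type*} [MeasurableSpace X] [PseudoEMetricSpace X] :
    Measure X → Measure X → ℝ≥0∞ := fun a b => W1 a b

/-- Wasserstein-1 distance on probability measures. -/
def W1P {X : Type*} [MeasurableSpace X] [PseudoEMetricSpace X] :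
    ProbabilityMeasure X → ProbabilityMeasure X → ℝ≥0∞ :=
  fun a b => W1 (a : Measure X) (b : Measure X)

/-- The admissible set `𝒜 = ℝ₊ ⬝ BV(I; 𝒲₁(Ω))` of weighted BV curves of probability measures. -/
def Adm {n : ℕ} (Ω : Set (EuclideanSpace ℝ (Fin n))) : Set (ℝ → Measure ↥Ω) :=
  {μ | ∃ (c : ℝ≥0) (ρ : ℝ → ProbabilityMeasure ↥Ω),
      essVar W1P ρ < ⊤ ∧ ∀ t, μ t = (c : ℝ≥0∞) • (ρ t : Measure ↥Ω)}

/-- The weight `ω(μ)` of an admissible curve. -/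
def wt {n : ℕ} {Ω : Set (EuclideanSpace ℝ (Fin n))} (μ : ℝ → Measure ↥Ω) : ℝ :=
  (μ 0 Set.univ).toReal

/-- The regularizer `𝓡_{α,β}(μ) = α ω(μ) + β essvar(μ)`. -/
def Reg {n : ℕ} {Ω : Set (EuclideanSpace ℝ (Fin n))} (α β : ℝ)
    (μ : ℝ → Measure ↥Ω) : ℝ :=
  α * wt μ + β * (essVar W1M μ).toReal

/-- Weak-* convergence of a sequence of measures (tested against continuous functions). -/
def WStarTendsto {X : Type*} [MeasurableSpace X] [TopologicalSpace X]
    (μs : ℕ → Measure X) (μ : Measure X) : Prop :=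
  ∀ φ : C(X, ℝ), Tendsto (fun j => ∫ x, φ x ∂(μs j)) atTop (𝓝 (∫ x, φ x ∂μ))

/-- A.e. (in time) weak-* convergence of curves of measures. -/
def AEWStar {n : ℕ} {Ω : Set (EuclideanSpace ℝ (Fin n))}
    (μs : ℕ → (ℝ → Measure ↥Ω)) (μ : ℝ → Measure ↥Ω) : Prop :=
  ∀ᵐ t ∂lebI, WStarTendsto (fun j => μs j t) (μ t)

/-- Weak convergence in a real inner product space. -/
def WeakTendsto {Y : Type*} [NormedAddCommGroup Y] [InnerProductSpace ℝ Y]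
    (ys : ℕ → Y) (y : Y) : Prop :=
  ∀ z : Y, Tendsto (fun j => @inner ℝ Y _ (ys j) z) atTop (𝓝 (@inner ℝ Y _ y z))


/-- **Helly's selection theorem** for curves in a compact first-countable space `X` that is
injectively and pointwise continuously embedded into a space of functions with uniform distance. -/
theorem exists_subseq_tendsto_of_eVariationOn_le {X ι : Type*} [TopologicalSpace X]
    [CompactSpace X] [FirstCountableTopology X] (e : X → UniformFun ι ℝ)
    (he : ∀ i, Continuous fun x => UniformFun.toFun (e x) i)
    (hsep : ∀ x y, (∀ i, UniformFun.toFun (e x) i = UniformFun.toFun (e y) i) → x = y)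
    (g : ℕ → ℝ → X) {M : ℝ≥0∞} (hM : M ≠ ⊤) (hg : ∀ j, eVariationOn (e ∘ g j) univ ≤ M) :
    ∃ ψ : ℕ → ℕ, StrictMono ψ ∧ ∃ G : ℝ → X,
      ∀ t, Tendsto (fun j => g (ψ j) t) atTop (𝓝 (G t)) := by
  set V : ℕ → ℝ → ℝ≥0∞ := fun j t => eVariationOn (e ∘ g j) (Iic t) with hV
  have hVadd : ∀ j {s t : ℝ}, s ≤ t →
      V j t = V j s + eVariationOn (e ∘ g j) (Icc s t) := by
    intro j s t hst
    rw [hV]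
    simp only
    rw [← eVariationOn.union (x := s) (e ∘ g j) isGreatest_Iic (isLeast_Icc hst),
      Iic_union_Icc_eq_Iic hst]
  obtain ⟨a, ψ₁, hψ₁, ha⟩ := SeqCompactSpace.tendsto_subseq
    (fun j => fun q : ℚ => (V j q, g j q))
  rw [tendsto_pi_nhds] at ha
  have haV : ∀ q : ℚ, Tendsto (fun j => V (ψ₁ j) q) atTop (𝓝 (a q).1) := fun q =>
    (continuous_fst.tendsto _).comp (ha q)
  have hag : ∀ q : ℚ, Tendsto (fun j => g (ψ₁ j) q) atTop (𝓝 (a q).2) := fun q =>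
    (continuous_snd.tendsto _).comp (ha q)
  set Vlim : ℝ → ℝ≥0∞ := fun t => limsup (fun j => V (ψ₁ j) t) atTop with hVlim
  have hVlim_mono : Monotone Vlim := by
    intro s t hst
    exact limsup_le_limsup (Eventually.of_forall fun j =>
      eVariationOn.mono _ (Iic_subset_Iic.2 hst))
  have hVlim_rat : ∀ q : ℚ, Vlim q = (a q).1 := fun q => (haV q).limsup_eq
  have hVlim_top : ∀ t, Vlim t ≠ ⊤ := by
    intro t
    refine ne_top_of_le_ne_top hM (limsup_le_of_le (by isBoundedDefault)
      (Eventually.of_forall fun j => ?_))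
    exact (eVariationOn.mono _ (subset_univ _)).trans (hg _)
  have hclose : ∀ t, ContinuousAt Vlim t → ∀ ε : ℝ≥0∞, 0 < ε → ε ≠ ⊤ → ∃ q : ℚ,
      ∀ᶠ j in atTop, edist (e (g (ψ₁ j) t)) (e (g (ψ₁ j) q)) ≤ ε := by
    intro t ht ε hε hεtop
    have hε4 : 0 < ε / 2 / 2 := ENNReal.half_pos (ENNReal.half_pos hε.ne').ne'
    have hnhds : ∀ᶠ s in 𝓝 t, Vlim s ∈ Icc (Vlim t - ε / 2 / 2) (Vlim t + ε / 2 / 2) :=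
      ht (ENNReal.Icc_mem_nhds (hVlim_top t) hε4.ne')
    obtain ⟨l, u, hlu, hsub⟩ := mem_nhds_iff_exists_Ioo_subset.1 hnhds
    obtain ⟨q, hq1, hq2⟩ := exists_rat_btwn hlu.1
    obtain ⟨r, hr1, hr2⟩ := exists_rat_btwn hlu.2
    have hq := (hsub ⟨hq1, hq2.trans hlu.2⟩).1
    have hr := (hsub ⟨hlu.1.trans hr1, hr2⟩).2
    rw [tsub_le_iff_right] at hq
    have hlim : (a r).1 < (a q).1 + ε := by
      rw [← hVlim_rat, ← hVlim_rat]
      calc Vlim r ≤ Vlim q + ε / 2 / 2 + ε / 2 / 2 := hr.trans (by gcongr)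
        _ = Vlim q + ε / 2 := by rw [add_assoc, ENNReal.add_halves]
        _ < Vlim q + ε :=
          ENNReal.add_lt_add_left (hVlim_top _) (ENNReal.half_lt_self hε.ne' hεtop)
    refine ⟨q, ?_⟩
    filter_upwards [(haV r).eventually_lt ((haV q).add_const ε) hlim] with j hj
    rw [hVadd _ (hq2.trans hr1).le] at hj
    have ht_mem : t ∈ Icc (q : ℝ) r := ⟨hq2.le, hr1.le⟩
    have hq_mem : (q : ℝ) ∈ Icc (q : ℝ) r := ⟨le_rfl, (hq2.trans hr1).le⟩
    exact (eVariationOn.edist_le (e ∘ g (ψ₁ j)) ht_mem hq_mem).trans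
      (lt_of_add_lt_add_left hj).le
  have hgood : ∀ t, ContinuousAt Vlim t →
      ∃ y, Tendsto (fun j => g (ψ₁ j) t) atTop (𝓝 y) := by
    intro t ht
    obtain ⟨y, -, hy⟩ := isCompact_univ.exists_mapClusterPt (f := atTop)
      (u := fun j => g (ψ₁ j) t) (by simp)
    have hcl : ∀ x, MapClusterPt x atTop (fun j => g (ψ₁ j) t) → ∀ ε : ℝ, 0 < ε → ∀ q : ℚ,
        (∀ᶠ j in atTop, edist (e (g (ψ₁ j) t)) (e (g (ψ₁ j) q)) ≤ ENNReal.ofReal ε) → ∀ i,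
        dist (UniformFun.toFun (e x) i) (UniformFun.toFun (e (a q).2) i) ≤ 2 * ε := by
      intro x hx ε hε q hq i
      have hclosed : IsClosed {z | dist (UniformFun.toFun (e z) i)
          (UniformFun.toFun (e (a q).2) i) ≤ 2 * ε} :=
        isClosed_le ((he i).dist continuous_const) continuous_const
      refine hclosed.mem_of_mapClusterPt hx ?_
      have h1 : ∀ᶠ j in atTop, dist (UniformFun.toFun (e (g (ψ₁ j) q)) i)
          (UniformFun.toFun (e (a q).2) i) < ε :=
        Metric.tendsto_nhds.1 (((he i).tendsto _).comp (hag q)) ε hε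
      filter_upwards [h1, hq] with j h1 h2
      have h3 : dist (UniformFun.toFun (e (g (ψ₁ j) t)) i)
          (UniformFun.toFun (e (g (ψ₁ j) q)) i) ≤ ε := by
        rw [← ENNReal.ofReal_le_ofReal_iff hε.le, ← edist_dist]
        exact UniformFun.edist_eval_le.trans h2
      exact (dist_triangle _ _ _).trans (by linarith)
    refine ⟨y, tendsto_nhds_of_unique_mapClusterPt fun x hx => hsep _ _ fun i => ?_⟩
    refine dist_le_zero.1 (le_of_forall_pos_le_add fun ε hε => ?_)
    obtain ⟨q, hq⟩ := hclose t ht (ENNReal.ofReal (ε / 4)) (by simpa using hε) ENNReal.ofReal_ne_top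
    have h1 := hcl x hx (ε / 4) (by positivity) q hq i
    have h2 := hcl y hy (ε / 4) (by positivity) q hq i
    have := dist_triangle_right (UniformFun.toFun (e x) i) (UniformFun.toFun (e y) i)
      (UniformFun.toFun (e (a q).2) i)
    linarith
  have hB : {t | ¬ ContinuousAt Vlim t}.Countable := hVlim_mono.countable_not_continuousAt
  have : Countable {t | ¬ ContinuousAt Vlim t} := hB
  obtain ⟨b, ψ₂, hψ₂, hb⟩ := SeqCompactSpace.tendsto_subseq
    (fun j => fun t : {t | ¬ ContinuousAt Vlim t} => g (ψ₁ j) t)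
  rw [tendsto_pi_nhds] at hb
  have hall : ∀ t, ∃ y, Tendsto (fun j => g (ψ₁ (ψ₂ j)) t) atTop (𝓝 y) := by
    intro t
    by_cases ht : ContinuousAt Vlim t
    · obtain ⟨y, hy⟩ := hgood t ht
      exact ⟨y, hy.comp hψ₂.tendsto_atTop⟩
    · exact ⟨b ⟨t, ht⟩, hb ⟨t, ht⟩⟩
  choose G hG using hall
  exact ⟨ψ₁ ∘ ψ₂, hψ₁.comp hψ₂, G, hG⟩

/-- The integral of a Lipschitz function varies at most by the Wasserstein distance. -/
theorem edist_integral_le_W1P {X : Type*} [PseudoMetricSpace X] [CompactSpace X]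
    [MeasurableSpace X] [BorelSpace X] [SecondCountableTopology X] {φ : X → ℝ}
    (hφ : LipschitzWith 1 φ)
    (a b : ProbabilityMeasure X) :
    edist (∫ x, φ x ∂(a : Measure X)) (∫ x, φ x ∂(b : Measure X)) ≤ W1P a b := by
  refine le_iInf₂ fun π hπ => ?_
  obtain ⟨h1, h2⟩ := hπ
  have hint : ∀ c : ProbabilityMeasure X, Integrable φ (c : Measure X) := fun c =>
    hφ.continuous.integrable_of_hasCompactSupport (HasCompactSupport.of_compactSpace φ)
  have hi1 : Integrable (fun q : X × X => φ q.1) π :=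
    Integrable.comp_measurable (by rw [h1]; exact hint a) measurable_fst
  have hi2 : Integrable (fun q : X × X => φ q.2) π :=
    Integrable.comp_measurable (by rw [h2]; exact hint b) measurable_snd
  have e1 : ∫ x, φ x ∂(a : Measure X) = ∫ q, φ q.1 ∂π := by
    rw [← h1, integral_map measurable_fst.aemeasurable hφ.continuous.aestronglyMeasurable]
  have e2 : ∫ x, φ x ∂(b : Measure X) = ∫ q, φ q.2 ∂π := by
    rw [← h2, integral_map measurable_snd.aemeasurable hφ.continuous.aestronglyMeasurable]
  rw [e1, e2, edist_eq_enorm_sub, ← integral_sub hi1 hi2]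
  refine (enorm_integral_le_lintegral_enorm _).trans (lintegral_mono fun q => ?_)
  rw [← edist_eq_enorm_sub]
  simpa using hφ q.1 q.2

/-- Probability measures are separated by `1`-Lipschitz functions. -/
theorem ProbabilityMeasure.ext_of_forall_lipschitz {X : Type*} [MetricSpace X]
    [MeasurableSpace X] [BorelSpace X] {a b : ProbabilityMeasure X}
    (h : ∀ φ : X → ℝ, LipschitzWith 1 φ →
      ∫ x, φ x ∂(a : Measure X) = ∫ x, φ x ∂(b : Measure X)) : a = b := by
  have : Tendsto (fun _ : ℕ => a) atTop (𝓝 b) := by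
    rw [tendsto_iff_forall_lipschitz_integral_tendsto]
    rintro φ - ⟨L, hL⟩
    have hpos : (0 : ℝ) < L + 1 := by positivity
    have h1 : LipschitzWith 1 fun x => ((L : ℝ) + 1)⁻¹ * φ x := by
      refine LipschitzWith.of_dist_le_mul fun x y => ?_
      have := hL.dist_le_mul x y
      rw [Real.dist_eq] at this ⊢
      rw [← mul_sub, abs_mul, abs_of_pos (inv_pos.2 hpos), inv_mul_le_iff₀ hpos]
      have := dist_nonneg (x := x) (y := y)
      push_cast
      nlinarith
    have h2 := h _ h1
    rw [integral_const_mul, integral_const_mul] at h2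
    rw [mul_left_cancel₀ (inv_pos.2 hpos).ne' h2]
    exact tendsto_const_nhds
  exact tendsto_nhds_unique tendsto_const_nhds this

/-- The Wasserstein distance is jointly lower semicontinuous. -/
theorem lowerSemicontinuous_W1P {X : Type*} [MetricSpace X] [CompactSpace X]
    [MeasurableSpace X] [BorelSpace X] :
    LowerSemicontinuous fun p : ProbabilityMeasure X × ProbabilityMeasure X => W1P p.1 p.2 := by
  rw [lowerSemicontinuous_iff_isClosed_preimage]
  intro c
  let cost : ProbabilityMeasure (X × X) → ℝ≥0∞ := fun π =>
    ∫⁻ q : X × X, edist q.1 q.2 ∂(π : Measure (X × X))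
  have hcost : Continuous cost := by
    have := ProbabilityMeasure.continuous_lintegral_boundedContinuousFunction
      (BoundedContinuousFunction.mkOfCompact
        ⟨fun q : X × X => nndist q.1 q.2, by fun_prop⟩)
    simpa only [cost, edist_nndist] using! this
  let marg : ProbabilityMeasure (X × X) → ProbabilityMeasure X × ProbabilityMeasure X :=
    fun π => (π.map continuous_fst.measurable.aemeasurable,
      π.map continuous_snd.measurable.aemeasurable)
  have hmarg : Continuous marg :=
    (ProbabilityMeasure.continuous_map continuous_fst).prodMk
      (ProbabilityMeasure.continuous_map continuous_snd)
  have hset : (fun p : ProbabilityMeasure X × ProbabilityMeasure X => W1P p.1 p.2) ⁻¹' Iic c =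
      ⋂ c' ∈ Ioi c, marg '' (cost ⁻¹' Iic c') := by
    ext ⟨x, y⟩
    simp only [mem_preimage, mem_Iic, mem_iInter, mem_Ioi]
    constructor
    · intro h c' hc'
      have h' : W1P x y < c' := h.trans_lt hc'
      simp only [W1P, W1, iInf_lt_iff] at h'
      obtain ⟨π, ⟨h1, h2⟩, hπ⟩ := h'
      have : IsProbabilityMeasure π := by
        refine ⟨?_⟩
        have := congrArg (fun m : Measure X => m univ) h1
        simpa [Measure.map_apply measurable_fst MeasurableSet.univ] using this
      refine ⟨⟨π, this⟩, hπ.le, Prod.ext (Subtype.ext ?_) (Subtype.ext ?_)⟩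
      · exact h1
      · exact h2
    · intro h
      refine le_of_forall_gt_imp_ge_of_dense fun c' hc' => ?_
      obtain ⟨π, hπ, hm⟩ := h c' hc'
      refine (iInf₂_le (π : Measure (X × X)) ⟨?_, ?_⟩).trans hπ
      · exact congrArg (fun p => ((p.1 : ProbabilityMeasure X) : Measure X)) hm
      · exact congrArg (fun p => ((p.2 : ProbabilityMeasure X) : Measure X)) hm
  rw [hset]
  exact isClosed_biInter fun c' _ =>
    ((isClosed_Iic.preimage hcost).isCompact.image hmarg).isClosed

/-- The variation is lower semicontinuous under pointwise convergence. -/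
theorem lowerSemicontinuous_varOn {X : Type*} [TopologicalSpace X] {d : X → X → ℝ≥0∞}
    (hd : LowerSemicontinuous fun p : X × X => d p.1 p.2) (s : Set ℝ) :
    LowerSemicontinuous fun f : ℝ → X => varOn d f s := by
  refine lowerSemicontinuous_iSup fun p => lowerSemicontinuous_sum fun i _ => ?_
  have hcont : Continuous fun f : ℝ → X => (f (p.2.1 (i + 1)), f (p.2.1 i)) := by fun_prop
  exact LowerSemicontinuous.comp hd hcont

/-- Compactness of curves of probability measures with bounded variation. -/
theorem exists_subseq_tendsto_of_varOn_le {X : Type*} [MetricSpace X] [CompactSpace X]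
    [MeasurableSpace X] [BorelSpace X] (r : ℕ → ℝ → ProbabilityMeasure X) {M : ℝ≥0∞}
    (hM : M ≠ ⊤) (hr : ∀ j, varOn W1P (r j) unitI ≤ M) :
    ∃ ψ : ℕ → ℕ, StrictMono ψ ∧ ∃ R : ℝ → ProbabilityMeasure X,
      ∀ t ∈ unitI, Tendsto (fun j => r (ψ j) t) atTop (𝓝 (R t)) := by
  let e : ProbabilityMeasure X → UniformFun {φ : X → ℝ // LipschitzWith 1 φ} ℝ := fun x =>
    UniformFun.ofFun fun φ => ∫ y, φ.1 y ∂(x : Measure X)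
  let clip : ℝ → ℝ := fun t => max 0 (min 1 t)
  have hclip : Monotone clip := fun s t h => max_le_max le_rfl (min_le_min le_rfl h)
  have hclip_mem : ∀ t, clip t ∈ unitI := fun t =>
    ⟨le_max_left _ _, max_le zero_le_one (min_le_left _ _)⟩
  have hclip_id : ∀ t ∈ unitI, clip t = t := fun t ht => by
    simp [clip, min_eq_right ht.2, max_eq_right ht.1]
  obtain ⟨ψ, hψ, R, hR⟩ := exists_subseq_tendsto_of_eVariationOn_le e
    (fun φ => ProbabilityMeasure.continuous_integral_boundedContinuousFunction
      (BoundedContinuousFunction.mkOfCompact ⟨φ.1, φ.2.continuous⟩))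
    (fun x y h => ProbabilityMeasure.ext_of_forall_lipschitz fun φ hφ => h ⟨φ, hφ⟩)
    (fun j => r j ∘ clip) hM (fun j => by
      refine (eVariationOn.comp_le_of_monotoneOn (e ∘ r j) clip (hclip.monotoneOn _)
        (fun t _ => hclip_mem t)).trans (le_trans (iSup_mono fun p => ?_) (hr j))
      refine Finset.sum_le_sum fun i _ => ?_
      rw [UniformFun.edist_le]
      exact fun φ => edist_integral_le_W1P φ.2 _ _)
  refine ⟨ψ, hψ, R, fun t ht => ?_⟩
  simpa [hclip_id t ht] using hR t

theorem varOn_congr {X : Type*} {d : X → X → ℝ≥0∞} {f g : ℝ → X} {s : Set ℝ}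
    (h : ∀ t ∈ s, f t = g t) : varOn d f s = varOn d g s := by
  refine iSup_congr fun p => Finset.sum_congr rfl fun i _ => ?_
  rw [h _ (p.2.2.2 _), h _ (p.2.2.2 _)]

theorem le_varOn {X : Type*} {d : X → X → ℝ≥0∞} {f : ℝ → X} {s : Set ℝ} {x y : ℝ}
    (hx : x ∈ s) (hy : y ∈ s) (hxy : x ≤ y) : d (f y) (f x) ≤ varOn d f s := by
  have hmono : Monotone fun i : ℕ => if i = 0 then x else y := by
    refine monotone_nat_of_le_succ fun i => ?_
    by_cases hi : i = 0 <;> simp [hi, hxy]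
  refine le_iSup_of_le ⟨1, _, hmono, fun i => ?_⟩ (by simp)
  by_cases hi : i = 0 <;> simp [hi, hx, hy]

theorem essVar_le_varOn {X : Type*} {d : X → X → ℝ≥0∞} {f g : ℝ → X}
    (h : ∀ᵐ t ∂(volume.restrict unitI), g t = f t) : essVar d f ≤ varOn d g unitI :=
  iInf₂_le g h

theorem W1_le_of_isCoupling {X : Type*} [PseudoEMetricSpace X] [MeasurableSpace X]
    {a b : Measure X} {π : Measure (X × X)} (h : IsCoupling a b π) :
    W1 a b ≤ ∫⁻ q, edist q.1 q.2 ∂π :=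
  iInf₂_le π h

theorem W1_self {X : Type*} [PseudoEMetricSpace X] [MeasurableSpace X] (a : Measure X) :
    W1 a a = 0 := by
  refine le_antisymm ?_ zero_le
  have hdiag : Measurable fun x : X => (x, x) := measurable_id.prodMk measurable_id
  refine (W1_le_of_isCoupling (π := a.map fun x => (x, x)) ⟨?_, ?_⟩).trans ?_
  · rw [Measure.map_map measurable_fst hdiag]
    exact Measure.map_id
  · rw [Measure.map_map measurable_snd hdiag]
    exact Measure.map_id
  · exact (lintegral_map_le _ _).trans (by simp)

theorem W1_smul_le {X : Type*} [PseudoEMetricSpace X] [MeasurableSpace X] (a b : Measure X)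
    {c : ℝ≥0∞} (hc : c ≠ 0) (hctop : c ≠ ⊤) : W1 (c • a) (c • b) ≤ c * W1 a b := by
  rw [W1, W1, ENNReal.mul_iInf_of_ne hc hctop]
  refine le_iInf fun π => ?_
  rw [ENNReal.mul_iInf_of_ne hc hctop]
  refine le_iInf fun hπ => (W1_le_of_isCoupling (π := c • π) ⟨?_, ?_⟩).trans ?_
  · rw [Measure.map_smul, hπ.1]
  · rw [Measure.map_smul, hπ.2]
  · rw [lintegral_smul_measure, smul_eq_mul]

theorem W1_smul {X : Type*} [PseudoEMetricSpace X] [MeasurableSpace X] (a b : Measure X)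
    {c : ℝ≥0∞} (hc : c ≠ 0) (hctop : c ≠ ⊤) : W1 (c • a) (c • b) = c * W1 a b := by
  refine (W1_smul_le a b hc hctop).antisymm ?_
  have h := W1_smul_le (c • a) (c • b) (ENNReal.inv_ne_zero.2 hctop) (ENNReal.inv_ne_top.2 hc)
  rw [smul_smul, smul_smul, ENNReal.inv_mul_cancel hc hctop, one_smul, one_smul] at h
  calc c * W1 a b ≤ c * (c⁻¹ * W1 (c • a) (c • b)) := by gcongr
    _ = W1 (c • a) (c • b) := by rw [← mul_assoc, ENNReal.mul_inv_cancel hc hctop, one_mul]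

/-- Measures at finite Wasserstein distance have the same mass. -/
theorem measure_univ_eq_of_W1_ne_top {X : Type*} [PseudoEMetricSpace X] [MeasurableSpace X]
    {a b : Measure X} (h : W1 a b ≠ ⊤) : a univ = b univ := by
  have h' := h.lt_top
  simp only [W1, iInf_lt_iff] at h'
  obtain ⟨π, ⟨h1, h2⟩, -⟩ := h'
  rw [← h1, ← h2, Measure.map_apply measurable_fst .univ, Measure.map_apply measurable_snd .univ]
  simp

theorem varOn_smul {X : Type*} [PseudoEMetricSpace X] [MeasurableSpace X]
    (r : ℝ → ProbabilityMeasure X) (s : Set ℝ) {c : ℝ≥0∞} (hc : c ≠ 0) (hctop : c ≠ ⊤) :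
    varOn W1M (fun t => c • (r t : Measure X)) s = c * varOn W1P r s := by
  simp only [varOn, W1M, W1P, W1_smul _ _ hc hctop, ENNReal.mul_iSup, Finset.mul_sum]

theorem essVar_const {X : Type*} {d : X → X → ℝ≥0∞} (x : X) (h : d x x = 0) :
    essVar d (fun _ => x) = 0 := by
  refine le_antisymm ((essVar_le_varOn (Eventually.of_forall fun _ => rfl)).trans ?_) zero_le
  simp [varOn, h]

theorem essVar_smul {X : Type*} [PseudoEMetricSpace X] [MeasurableSpace X]
    (ρ : ℝ → ProbabilityMeasure X) {c : ℝ≥0∞} (hc : c ≠ 0) (hctop : c ≠ ⊤) :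
    essVar W1M (fun t => c • (ρ t : Measure X)) = c * essVar W1P ρ := by
  refine le_antisymm ?_ ?_
  · simp only [essVar, essVarOn]
    rw [ENNReal.mul_iInf_of_ne hc hctop]
    refine le_iInf fun r => ?_
    rw [ENNReal.mul_iInf_of_ne hc hctop]
    refine le_iInf fun hr => ?_
    rw [← varOn_smul r _ hc hctop]
    refine essVar_le_varOn ?_
    filter_upwards [hr] with t ht
    rw [ht]
  · refine le_iInf₂ fun g hg => ?_
    replace hg : ∀ᵐ t ∂(volume.restrict unitI), g t = c • (ρ t : Measure X) := hg
    by_cases hvar : varOn W1M g unitI = ⊤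
    · simp [hvar]
    obtain ⟨t₀, ht₀, ht₀I⟩ : ∃ t, g t = c • (ρ t : Measure X) ∧ t ∈ unitI := by
      have hne : (ae (volume.restrict unitI)).NeBot := by
        rw [ae_neBot, Ne, Measure.restrict_eq_zero]
        simp [unitI]
      have hI : ∀ᵐ t ∂(volume.restrict unitI), t ∈ unitI :=
        ae_restrict_mem measurableSet_Icc
      exact (hg.and hI).exists
    have hmass : ∀ t ∈ unitI, g t univ = c := by
      intro t ht
      have h0 : g t₀ univ = c := by simp [ht₀]
      rw [← h0]
      rcases le_total t t₀ with h | h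
      · exact (measure_univ_eq_of_W1_ne_top (ne_top_of_le_ne_top hvar (le_varOn ht ht₀I h))).symm
      · exact measure_univ_eq_of_W1_ne_top (ne_top_of_le_ne_top hvar (le_varOn ht₀I ht h))
    have hprob : ∀ t, g t univ = c → IsProbabilityMeasure (c⁻¹ • g t) := fun t ht =>
      ⟨by simp [ht, ENNReal.inv_mul_cancel hc hctop]⟩
    classical
    let r : ℝ → ProbabilityMeasure X := fun t =>
      if h : g t univ = c then ⟨c⁻¹ • g t, hprob t h⟩ else ρ t
    have hr : ∀ t, g t univ = c → g t = c • (r t : Measure X) := by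
      intro t ht
      have hrt : (r t : Measure X) = c⁻¹ • g t :=
        congrArg ProbabilityMeasure.toMeasure (dif_pos ht)
      rw [hrt, smul_smul, ENNReal.mul_inv_cancel hc hctop, one_smul]
    rw [varOn_congr fun t ht => hr t (hmass t ht), varOn_smul r _ hc hctop]
    gcongr
    refine essVar_le_varOn ?_
    filter_upwards [hg] with t ht
    refine Subtype.ext ?_
    have hmt : g t univ = c := by simp [ht]
    change (r t : Measure X) = ρ t
    have h2 := (hr t hmt).symm.trans ht
    have h3 := congrArg (fun m : Measure X => c⁻¹ • m) h2
    simpa [smul_smul, ENNReal.inv_mul_cancel hc hctop] using h3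

/-- Curves of probability measures whose essential variations converge have a subsequence that
converges almost everywhere, and the essential variation does not increase in the limit. -/
theorem exists_subseq_ae_tendsto {X : Type*} [MetricSpace X] [CompactSpace X]
    [MeasurableSpace X] [BorelSpace X] (ρ : ℕ → ℝ → ProbabilityMeasure X)
    (hfin : ∀ j, essVar W1P (ρ j) ≠ ⊤) {v : ℝ}
    (hv : Tendsto (fun j => (essVar W1P (ρ j)).toReal) atTop (𝓝 v)) :
    ∃ ψ : ℕ → ℕ, StrictMono ψ ∧ ∃ R : ℝ → ProbabilityMeasure X,
      essVar W1P R ≤ ENNReal.ofReal v ∧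
      ∀ᵐ t ∂lebI, Tendsto (fun j => ρ (ψ j) t) atTop (𝓝 (R t)) := by
  have hrep : ∀ j : ℕ, ∃ r : ℝ → ProbabilityMeasure X,
      (∀ᵐ t ∂(volume.restrict unitI), r t = ρ j t) ∧
      varOn W1P r unitI < essVar W1P (ρ j) + ((j : ℝ≥0∞) + 1)⁻¹ := by
    intro j
    have hlt : essVar W1P (ρ j) < essVar W1P (ρ j) + ((j : ℝ≥0∞) + 1)⁻¹ :=
      ENNReal.lt_add_right (hfin j) (by simp)
    conv_lhs at hlt => rw [essVar, essVarOn]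
    simp only [iInf_lt_iff] at hlt
    obtain ⟨r, hr, hlt⟩ := hlt
    exact ⟨r, hr, hlt⟩
  choose r hr hrv using hrep
  obtain ⟨B, hB⟩ := hv.bddAbove_range
  have hbound : ∀ j, varOn W1P (r j) unitI ≤ ENNReal.ofReal B + 1 := by
    intro j
    refine (hrv j).le.trans (add_le_add ?_ (by simp))
    exact (ENNReal.le_ofReal_iff_toReal_le (hfin j)
      (ENNReal.toReal_nonneg.trans (hB ⟨j, rfl⟩))).2 (hB ⟨j, rfl⟩)
  obtain ⟨ψ, hψ, R, hR⟩ := exists_subseq_tendsto_of_varOn_le r (by simp) hbound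
  refine ⟨ψ, hψ, R, ?_, ?_⟩
  · refine (essVar_le_varOn (Eventually.of_forall fun _ => rfl)).trans
      (le_of_forall_lt_imp_le_of_dense fun y hy => ?_)
    classical
    have hpw : Tendsto (fun j => unitI.piecewise (r (ψ j)) R) atTop (𝓝 R) := by
      rw [tendsto_pi_nhds]
      intro t
      by_cases ht : t ∈ unitI
      · simpa [ht] using hR t ht
      · simp [ht]
    have hev := hpw.eventually (lowerSemicontinuous_varOn lowerSemicontinuous_W1P unitI R y hy)
    have hlim : Tendsto (fun j : ℕ => essVar W1P (ρ j) + ((j : ℝ≥0∞) + 1)⁻¹) atTop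
        (𝓝 (ENNReal.ofReal v + 0)) := by
      refine Tendsto.add ?_ ?_
      · simpa [ENNReal.ofReal_toReal (hfin _)] using ENNReal.tendsto_ofReal hv
      · have := (tendsto_add_atTop_iff_nat 1).2 ENNReal.tendsto_inv_nat_nhds_zero
        simpa using this
    rw [add_zero] at hlim
    refine ge_of_tendsto (hlim.comp hψ.tendsto_atTop) ?_
    filter_upwards [hev] with j hj
    rw [varOn_congr (g := r (ψ j)) fun t ht => by simp [ht]] at hj
    exact (hj.trans (hrv (ψ j))).le
  · have hall : ∀ᵐ t ∂lebI, ∀ j, r j t = ρ j t := ae_all_iff.2 hr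
    have hI : ∀ᵐ t ∂lebI, t ∈ unitI := ae_restrict_mem measurableSet_Icc
    filter_upwards [hall, hI] with t ht htI
    simpa [ht] using hR t htI

theorem zero_mem_Adm {n : ℕ} {Ω : Set (EuclideanSpace ℝ (Fin n))} (hΩ : Ω.Nonempty) :
    (fun _ => 0 : ℝ → Measure ↥Ω) ∈ Adm Ω := by
  obtain ⟨x, hx⟩ := hΩ
  let p : ProbabilityMeasure Ω := ⟨Measure.dirac ⟨x, hx⟩, inferInstance⟩
  refine ⟨0, fun _ => p, ?_, fun t => by simp⟩
  rw [essVar_const (d := W1P) p (W1_self _)]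
  exact ENNReal.zero_lt_top

theorem Reg_zero {n : ℕ} {Ω : Set (EuclideanSpace ℝ (Fin n))} (α β : ℝ) :
    Reg α β (fun _ => 0 : ℝ → Measure ↥Ω) = 0 := by
  rw [Reg, essVar_const (d := W1M) _ (W1_self _)]
  simp [wt]

/-- Weighted curves whose weights and essential variations converge have a subsequence that
converges almost everywhere weak-*, with control of the regularizer of the limit. -/
theorem exists_subseq_AEWStar {n : ℕ} {Ω : Set (EuclideanSpace ℝ (Fin n))} (hΩ : Ω.Nonempty)
    (hΩc : IsCompact Ω) {α β : ℝ} (hβ : 0 ≤ β) (μs : ℕ → ℝ → Measure ↥Ω)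
    (hμs : ∀ j, μs j ∈ Adm Ω) {c e : ℝ} (hc : Tendsto (fun j => wt (μs j)) atTop (𝓝 c))
    (he : Tendsto (fun j => (essVar W1M (μs j)).toReal) atTop (𝓝 e)) :
    ∃ ψ : ℕ → ℕ, StrictMono ψ ∧ ∃ μ ∈ Adm Ω, AEWStar (fun k => μs (ψ k)) μ ∧
      Reg α β μ ≤ α * c + β * e := by
  have : CompactSpace Ω := isCompact_iff_compactSpace.1 hΩc
  choose w ρ hρ hμρ using hμs
  have hμ : ∀ j, μs j = fun t => (w j : ℝ≥0∞) • (ρ j t : Measure Ω) := fun j => funext (hμρ j)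
  have hwt : ∀ j, wt (μs j) = w j := fun j => by simp [wt, hμρ]
  simp only [hwt] at hc
  have hc0 : 0 ≤ c := ge_of_tendsto' hc fun j => (w j).2
  have he0 : 0 ≤ e := ge_of_tendsto' he fun j => ENNReal.toReal_nonneg
  rcases hc0.eq_or_lt with rfl | hcpos
  · refine ⟨id, strictMono_id, _, zero_mem_Adm hΩ, Eventually.of_forall fun t φ => ?_, ?_⟩
    · simp only [id, hμρ, integral_zero_measure]
      refine squeeze_zero_norm (a := fun j => (w j : ℝ) * ‖φ‖) (fun j => ?_)
        (by simpa using hc.mul_const ‖φ‖)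
      rw [integral_smul_measure, norm_smul]
      refine mul_le_mul (by simp) ?_ (norm_nonneg _) (by simp)
      simpa using norm_integral_le_of_norm_le_const (μ := (ρ j t : Measure Ω))
        (Eventually.of_forall φ.norm_coe_le_norm)
    · rw [Reg_zero]
      simpa using mul_nonneg hβ he0
  · have hv : Tendsto (fun j => (essVar W1P (ρ j)).toReal) atTop (𝓝 (e / c)) := by
      refine (he.div hc hcpos.ne').congr' ?_
      filter_upwards [hc.eventually_const_lt hcpos] with j hj
      have hj' : (w j : ℝ≥0∞) ≠ 0 := by
        intro h
        simp only [ENNReal.coe_eq_zero] at h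
        simp [h] at hj
      rw [Pi.div_apply, hμ j, essVar_smul _ hj' ENNReal.coe_ne_top, ENNReal.toReal_mul]
      simp only [ENNReal.coe_toReal]
      field_simp
    obtain ⟨ψ, hψ, R, hR, hconv⟩ := exists_subseq_ae_tendsto ρ (fun j => (hρ j).ne) hv
    lift c to ℝ≥0 using hc0
    refine ⟨ψ, hψ, fun t => (c : ℝ≥0∞) • (R t : Measure Ω),
      ⟨c, R, hR.trans_lt ENNReal.ofReal_lt_top, fun t => rfl⟩, ?_, ?_⟩
    · filter_upwards [hconv] with t ht φ
      simp only [hμρ, integral_smul_measure, ENNReal.coe_toReal]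
      exact (hc.comp hψ.tendsto_atTop).smul
        (ProbabilityMeasure.tendsto_iff_forall_integral_tendsto.1 ht
          (BoundedContinuousFunction.mkOfCompact φ))
    · have hcne : (c : ℝ≥0∞) ≠ 0 := by
        simpa using (NNReal.coe_pos.1 hcpos).ne'
      rw [Reg, essVar_smul _ hcne ENNReal.coe_ne_top, ENNReal.toReal_mul]
      have h1 : wt (fun t => (c : ℝ≥0∞) • (R t : Measure Ω)) = c := by simp [wt]
      rw [h1, ENNReal.coe_toReal]
      gcongr
      have h2 := ENNReal.toReal_le_of_le_ofReal (by positivity) hR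
      calc (c : ℝ) * (essVar W1P R).toReal ≤ c * (e / c) := by gcongr
        _ = e := by field_simp

/-- Stability for the BV curve tracking problem with quadratic fidelity.
If `fʲ → f̂` strongly in `Y` and each `μʲ` minimizes `½‖K(μ) − fʲ‖² + 𝓡_{α,β}(μ)` over `𝒜`,
then a subsequence of `(μʲ)` converges a.e. weak-* to some `μ̂ ∈ 𝒜`, and `μ̂` minimizes
`½‖K(μ) − f̂‖² + 𝓡_{α,β}(μ)` over `𝒜`. -/
theorem bv_curve_tracking_stability
    {n : ℕ} (Ω : Set (EuclideanSpace ℝ (Fin n)))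
    (hΩne : Ω.Nonempty) (hΩcp : IsCompact Ω) (hΩcv : Convex ℝ Ω)
    {Y : Type*} [NormedAddCommGroup Y] [InnerProductSpace ℝ Y] [CompleteSpace Y]
    (K : (ℝ → Measure ↥Ω) → Y)
    (hK : ∀ (μs : ℕ → (ℝ → Measure ↥Ω)) (μ : ℝ → Measure ↥Ω),
      (∀ j, μs j ∈ Adm Ω) → μ ∈ Adm Ω → AEWStar μs μ →
      WeakTendsto (fun j => K (μs j)) (K μ))
    (α β : ℝ) (hα : 0 < α) (hβ : 0 < β)
    (f : ℕ → Y) (fhat : Y) (hf : Tendsto f atTop (𝓝 fhat))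
    (μs : ℕ → (ℝ → Measure ↥Ω)) (hμsAdm : ∀ j, μs j ∈ Adm Ω)
    (hμsOpt : ∀ j, ∀ ν ∈ Adm Ω,
      (1 / 2) * ‖K (μs j) - f j‖ ^ 2 + Reg α β (μs j) ≤
        (1 / 2) * ‖K ν - f j‖ ^ 2 + Reg α β ν) :
    ∃ φ : ℕ → ℕ, StrictMono φ ∧ ∃ μhat ∈ Adm Ω,
      AEWStar (fun k => μs (φ k)) μhat ∧
      ∀ ν ∈ Adm Ω,
        (1 / 2) * ‖K μhat - fhat‖ ^ 2 + Reg α β μhat ≤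
          (1 / 2) * ‖K ν - fhat‖ ^ 2 + Reg α β ν := by
  have hzero := zero_mem_Adm hΩne
  have hlim : Tendsto (fun j => (1 / 2) * ‖K (fun _ => 0) - f j‖ ^ 2) atTop
      (𝓝 ((1 / 2) * ‖K (fun _ => 0) - fhat‖ ^ 2)) :=
    ((tendsto_const_nhds.sub hf).norm.pow 2).const_mul _
  obtain ⟨C, hC⟩ := hlim.bddAbove_range
  have hReg : ∀ j, Reg α β (μs j) ≤ C := by
    intro j
    have h1 := hμsOpt j _ hzero
    rw [Reg_zero] at h1
    have h2 : (1 / 2) * ‖K (fun _ => 0) - f j‖ ^ 2 ≤ C := hC ⟨j, rfl⟩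
    have h3 : 0 ≤ (1 / 2) * ‖K (μs j) - f j‖ ^ 2 := by positivity
    linarith
  have hmem : ∀ j, (wt (μs j), (essVar W1M (μs j)).toReal) ∈
      Icc (0 : ℝ) (C / α) ×ˢ Icc (0 : ℝ) (C / β) := by
    intro j
    have hw : 0 ≤ wt (μs j) := ENNReal.toReal_nonneg
    have hv : 0 ≤ (essVar W1M (μs j)).toReal := ENNReal.toReal_nonneg
    have h1 := hReg j
    rw [Reg] at h1
    have h2 := mul_nonneg hα.le hw
    have h3 := mul_nonneg hβ.le hv
    refine ⟨⟨hw, ?_⟩, hv, ?_⟩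
    · rw [le_div_iff₀' hα]
      linarith
    · rw [le_div_iff₀' hβ]
      linarith
  obtain ⟨⟨c, e⟩, -, φ₀, hφ₀, hce⟩ := (isCompact_Icc.prod isCompact_Icc).tendsto_subseq hmem
  have hc : Tendsto (fun j => wt (μs (φ₀ j))) atTop (𝓝 c) :=
    (continuous_fst.tendsto _).comp hce
  have he : Tendsto (fun j => (essVar W1M (μs (φ₀ j))).toReal) atTop (𝓝 e) :=
    (continuous_snd.tendsto _).comp hce
  obtain ⟨ψ, hψ, μhat, hμhat, hconv, hle⟩ := exists_subseq_AEWStar hΩne hΩcp (α := α) hβ.le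
    (fun j => μs (φ₀ j)) (fun j => hμsAdm _) hc he
  refine ⟨φ₀ ∘ ψ, hφ₀.comp hψ, μhat, hμhat, hconv, fun ν hν => ?_⟩
  set w := K μhat - fhat with hw
  have hf' : Tendsto (fun j => f (φ₀ (ψ j))) atTop (𝓝 fhat) :=
    hf.comp (hφ₀.comp hψ).tendsto_atTop
  have hweak : Tendsto (fun j => @inner ℝ Y _ (K (μs (φ₀ (ψ j))) - f (φ₀ (ψ j))) w) atTop
      (𝓝 (‖w‖ ^ 2)) := by
    have h1 := (hK _ _ (fun j => hμsAdm (φ₀ (ψ j))) hμhat hconv w).sub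
      (hf'.inner (tendsto_const_nhds (x := w)))
    rw [← inner_sub_left, real_inner_self_eq_norm_sq] at h1
    simpa only [inner_sub_left] using h1
  have hRegLim : Tendsto (fun j => Reg α β (μs (φ₀ (ψ j)))) atTop (𝓝 (α * c + β * e)) :=
    ((hc.const_mul α).add (he.const_mul β)).comp hψ.tendsto_atTop
  have hrhs : Tendsto (fun j => (1 / 2) * ‖K ν - f (φ₀ (ψ j))‖ ^ 2 + Reg α β ν) atTop
      (𝓝 ((1 / 2) * ‖K ν - fhat‖ ^ 2 + Reg α β ν)) :=
    (((tendsto_const_nhds.sub hf').norm.pow 2).const_mul _).add_const _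
  have hfinal := le_of_tendsto_of_tendsto'
    ((hweak.sub_const ((1 / 2) * ‖w‖ ^ 2)).add hRegLim) hrhs fun j => by
      refine le_trans ?_ (hμsOpt (φ₀ (ψ j)) ν hν)
      have h1 := norm_sub_sq_real (K (μs (φ₀ (ψ j))) - f (φ₀ (ψ j))) w
      have h2 := sq_nonneg ‖K (μs (φ₀ (ψ j))) - f (φ₀ (ψ j)) - w‖
      linarith
  linarith

end
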